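/- Let 0 < α < 5/12 and let s satisfy −1 < s < −α. Then there exist ε > 0 and C > 0, depending only on α and s, such that for all signs σ, σ₁, σ₂, σ₃ ∈ {−1, 1}, all dyadic numbers N₁, N₂, N₃, N₄, and every m ∈ ℤ: ∑_{n₁,n₂,n₃,n₄ ∈ ℤ²} ( ∏_{j=1}^{4} 1_{|n_j| ∼ N_j} · ⟨n_j⟩^{−2+2α} ) · ⟨n₁+n₂+n₃+n₄⟩^{2s} · ⟨n₁+n₂+n₃⟩^{−2} · 1_{|φ(n₁,n₂,n₃) − m| ≤ 1} ≤ C · N₄^{−2ε} · max(N₁, N₂, N₃)^{−2s_α}. -/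

import Mathlib

/-- The Euclidean norm of a lattice point `x ∈ ℤ²`. -/
noncomputable def znorm (x : Fin 2 → ℤ) : ℝ :=
  Real.sqrt ((x 0 : ℝ) ^ 2 + (x 1 : ℝ) ^ 2)

/-- The Japanese bracket `⟨x⟩ = √(1 + |x|²)` for lattice points `x ∈ ℤ²`. -/
noncomputable def jb (x : Fin 2 → ℤ) : ℝ :=
  Real.sqrt (1 + (x 0 : ℝ) ^ 2 + (x 1 : ℝ) ^ 2)

/-- `|x| ∼ N`, i.e. `N/2 ≤ |x| ≤ 2N`. -/
def ann (N : ℝ) (x : Fin 2 → ℤ) : Prop :=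
  N / 2 ≤ znorm x ∧ znorm x ≤ 2 * N

/-- The cubic phase function `φ(n₁,n₂,n₃) = σ⟨n₁+n₂+n₃⟩ + σ₁⟨n₁⟩ + σ₂⟨n₂⟩ + σ₃⟨n₃⟩`. -/
noncomputable def phase (σ σ₁ σ₂ σ₃ : ℝ) (n₁ n₂ n₃ : Fin 2 → ℤ) : ℝ :=
  σ * jb (n₁ + n₂ + n₃) + σ₁ * jb n₁ + σ₂ * jb n₂ + σ₃ * jb n₃

/-- The median (middle value) of three real numbers. -/
noncomputable def med3 (a b c : ℝ) : ℝ :=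
  max (min a b) (min (max a b) c)

-- `s_α = 1 − 2α` for `0 < α < 1/4` and `s_α = 5/4 − 3α` for `1/4 ≤ α < 5/12`.
open Classical in
noncomputable def sAlpha (α : ℝ) : ℝ :=
  if α < 1 / 4 then 1 - 2 * α else 5 / 4 - 3 * α

/-- A finite set of integers of diameter at most `D` has at most `D + 1` elements. -/
lemma card_le_of_diam (U : Finset ℤ) (D : ℝ) (hD : 0 ≤ D)
    (h : ∀ x ∈ U, ∀ y ∈ U, x ≤ y → (y : ℝ) - x ≤ D) : (U.card : ℝ) ≤ D + 1 := by
  rcases U.eq_empty_or_nonempty with rfl | hU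
  · simp; linarith
  · have hsub : U ⊆ Finset.Icc (U.min' hU) (U.min' hU + ⌊D⌋) := by
      intro y hy
      have h1 := U.min'_le y hy
      have h2 := h _ (U.min'_mem hU) y hy h1
      rw [Finset.mem_Icc]
      refine ⟨h1, ?_⟩
      have : y - U.min' hU ≤ ⌊D⌋ := Int.le_floor.mpr (by push_cast; exact h2)
      linarith
    have hc := Finset.card_le_card hsub
    rw [Int.card_Icc] at hc
    have h0 : 0 ≤ ⌊D⌋ := Int.floor_nonneg.mpr hD
    have h3 : (U.card : ℤ) ≤ ⌊D⌋ + 1 := by omega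
    have h4 : (U.card : ℝ) ≤ (⌊D⌋ : ℝ) + 1 := by exact_mod_cast h3
    linarith [Int.floor_le D]

lemma card_le_of_abs_le (U : Finset ℤ) (D : ℝ) (hD : 0 ≤ D)
    (h : ∀ x ∈ U, |(x : ℝ)| ≤ D) : (U.card : ℝ) ≤ 2 * D + 1 := by
  refine card_le_of_diam U _ (by linarith) fun x hx y hy _ => ?_
  have h1 := abs_le.mp (h x hx)
  have h2 := abs_le.mp (h y hy)
  linarith

lemma sum_natAbs_le (U : Finset ℤ) (F : ℕ → ℝ) (hF : ∀ k, 0 ≤ F k) :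
    ∑ i ∈ U, F i.natAbs ≤ 2 * ∑ k ∈ U.image Int.natAbs, F k := by
  rw [Finset.sum_comp F Int.natAbs, Finset.mul_sum]
  refine Finset.sum_le_sum fun k _ => ?_
  rw [nsmul_eq_mul]
  refine mul_le_mul_of_nonneg_right ?_ (hF k)
  have hsub : U.filter (fun a => a.natAbs = k) ⊆ {(k : ℤ), -(k : ℤ)} := by
    intro a ha
    simp only [Finset.mem_filter] at ha
    simp only [Finset.mem_insert, Finset.mem_singleton]
    omega
  have := (Finset.card_le_card hsub).trans Finset.card_le_two
  exact_mod_cast this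

lemma sum_inv_sq_add_sq_le (U : Finset ℤ) (y : ℝ) (hy : 1 ≤ y) :
    ∑ j ∈ U, 1 / (y ^ 2 + (j : ℝ) ^ 2) ≤ 8 / y := by
  have h1 : ∑ j ∈ U, 1 / (y ^ 2 + (j : ℝ) ^ 2) =
      ∑ j ∈ U, (fun k : ℕ => 1 / (y ^ 2 + (k : ℝ) ^ 2)) j.natAbs := by
    refine Finset.sum_congr rfl fun j _ => ?_
    simp only [Nat.cast_natAbs, Int.cast_abs, sq_abs]
  rw [h1]
  refine (sum_natAbs_le U (fun k : ℕ => 1 / (y ^ 2 + (k : ℝ) ^ 2)) fun k => by positivity).trans ?_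
  obtain ⟨M, hM⟩ := (U.image Int.natAbs).exists_nat_subset_range
  have h2 : ∀ M : ℕ, ∑ k ∈ Finset.range M, 1 / (y ^ 2 + (k : ℝ) ^ 2) ≤
      4 / y - 4 / (y + M) := by
    intro M
    induction M with
    | zero => simp
    | succ k ih =>
      rw [Finset.sum_range_succ]
      have hk : (0 : ℝ) ≤ k := Nat.cast_nonneg k
      have h3 : 1 / (y ^ 2 + (k : ℝ) ^ 2) ≤ 4 / (y + k) - 4 / (y + (k + 1)) := by
        rw [div_sub_div _ _ (by positivity) (by positivity),
          div_le_div_iff₀ (by positivity) (by positivity)]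
        nlinarith [sq_nonneg (y - k), mul_nonneg hk hk]
      push_cast
      linarith
  have h4 : ∑ k ∈ U.image Int.natAbs, 1 / (y ^ 2 + (k : ℝ) ^ 2) ≤ 4 / y := by
    refine (Finset.sum_le_sum_of_subset_of_nonneg hM fun _ _ _ => by positivity).trans
      ((h2 M).trans ?_)
    have : 0 ≤ 4 / (y + M) := by positivity
    linarith
  calc 2 * ∑ k ∈ U.image Int.natAbs, 1 / (y ^ 2 + (k : ℝ) ^ 2) ≤ 2 * (4 / y) := by gcongr
    _ = 8 / y := by ring

/-- The real-variable bracket `√(1 + u² + w²)`. -/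
noncomputable def bracket (u w : ℝ) : ℝ := Real.sqrt (1 + u ^ 2 + w ^ 2)

lemma bracket_pos (u w : ℝ) : 0 < bracket u w := Real.sqrt_pos.mpr (by positivity)

lemma bracket_sq (u w : ℝ) : bracket u w ^ 2 = 1 + u ^ 2 + w ^ 2 :=
  Real.sq_sqrt (by positivity)

lemma abs_le_bracket_left (u w : ℝ) : |u| ≤ bracket u w :=
  Real.abs_le_sqrt (by nlinarith [sq_nonneg w])

lemma abs_le_bracket_right (u w : ℝ) : |w| ≤ bracket u w :=
  Real.abs_le_sqrt (by nlinarith [sq_nonneg u])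

lemma bracket_sub_le (u w u' w' : ℝ) :
    |bracket u w - bracket u' w'| ≤ |u - u'| + |w - w'| := by
  have hp := bracket_pos u w
  have hp' := bracket_pos u' w'
  have h1 : (bracket u w - bracket u' w') * (bracket u w + bracket u' w') =
      (u - u') * (u + u') + (w - w') * (w + w') := by
    linear_combination bracket_sq u w - bracket_sq u' w'
  have h2 : |u + u'| ≤ bracket u w + bracket u' w' :=
    (abs_add_le _ _).trans (add_le_add (abs_le_bracket_left _ _) (abs_le_bracket_left _ _))
  have h3 : |w + w'| ≤ bracket u w + bracket u' w' :=
    (abs_add_le _ _).trans (add_le_add (abs_le_bracket_right _ _) (abs_le_bracket_right _ _))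
  have hs : 0 < bracket u w + bracket u' w' := by linarith
  refine le_of_mul_le_mul_right ?_ hs
  calc |bracket u w - bracket u' w'| * (bracket u w + bracket u' w')
      = |(u - u') * (u + u') + (w - w') * (w + w')| := by
        rw [← h1, abs_mul, abs_of_pos hs]
    _ ≤ |u - u'| * |u + u'| + |w - w'| * |w + w'| := by
        refine (abs_add_le _ _).trans ?_
        rw [abs_mul, abs_mul]
    _ ≤ |u - u'| * (bracket u w + bracket u' w') + |w - w'| * (bracket u w + bracket u' w') := by
        gcongr
    _ = _ := by ring

lemma bracket_le {u w R : ℝ} {c : ℝ} (hc : 0 ≤ c) (hR : 0 ≤ R)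
    (h : 1 + u ^ 2 + w ^ 2 ≤ (c * R) ^ 2) : bracket u w ≤ c * R :=
  Real.sqrt_le_iff.mpr ⟨by positivity, h⟩

lemma bracket_mono_right (u : ℝ) {w w' : ℝ} (hw : 0 ≤ w) (h : w ≤ w') :
    bracket u w ≤ bracket u w' := by
  unfold bracket
  gcongr

lemma bracket_neg_right (u w : ℝ) : bracket u (-w) = bracket u w := by simp [bracket]

lemma card_slice_add (N μ L u : ℝ) (hN : 1 ≤ N) (hu : |u| ≤ 3 * N) (U : Finset ℤ)
    (h0 : ∀ j ∈ U, 0 ≤ j)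
    (h : ∀ j ∈ U, |(j : ℝ)| ≤ 3 * N ∧ |bracket u j + bracket (u - L) j - μ| ≤ 5) :
    (U.card : ℝ) ≤ 11 * Real.sqrt N := by
  have hs : 1 ≤ Real.sqrt N := Real.one_le_sqrt.mpr hN
  have hss : Real.sqrt N ^ 2 = N := Real.sq_sqrt (by linarith)
  refine (card_le_of_diam U (10 * Real.sqrt N) (by positivity) fun i hi j hj hij => ?_).trans
    (by linarith)
  have hi0 : (0 : ℝ) ≤ i := by exact_mod_cast h0 i hi
  have hij' : (i : ℝ) ≤ j := by exact_mod_cast hij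
  obtain ⟨hiN, hi1⟩ := h i hi
  obtain ⟨hjN, hj1⟩ := h j hj
  have h1 := bracket_mono_right (u - L) hi0 hij'
  have h2 : bracket u j - bracket u i ≤ 10 := by
    have := (abs_le.mp hi1).1
    have := (abs_le.mp hj1).2
    linarith
  have hu2 : u ^ 2 ≤ 9 * N ^ 2 := by
    have := sq_le_sq' (by linarith [abs_nonneg u]) hu
    rw [sq_abs] at this; linarith
  have hb : ∀ w : ℝ, |w| ≤ 3 * N → bracket u w ≤ 5 * N := fun w hw => by
    refine bracket_le (by norm_num) (by linarith) ?_
    have := sq_le_sq' (by linarith [abs_nonneg w]) hw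
    rw [sq_abs] at this
    nlinarith
  have h3 := hb _ hiN
  have h4 := hb _ hjN
  have h5 : (j : ℝ) ^ 2 - (i : ℝ) ^ 2 ≤ 100 * N := by
    have e : (j : ℝ) ^ 2 - (i : ℝ) ^ 2 =
        (bracket u j - bracket u i) * (bracket u j + bracket u i) := by
      linear_combination bracket_sq u i - bracket_sq u j
    rw [e]
    have := bracket_pos u i
    have := bracket_pos u j
    nlinarith
  refine abs_le_of_sq_le_sq' ?_ (by positivity) |>.2
  nlinarith

lemma card_add_le (N μ L : ℝ) (hN : 1 ≤ N) (S : Finset (ℤ × ℤ))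
    (h : ∀ p ∈ S, |(p.1 : ℝ)| ≤ 3 * N ∧ |(p.2 : ℝ)| ≤ 3 * N ∧
      |bracket p.1 p.2 + bracket (p.1 - L) p.2 - μ| ≤ 5) :
    (S.card : ℝ) ≤ 154 * (N * Real.sqrt N) := by
  classical
  have hs : 1 ≤ Real.sqrt N := Real.one_le_sqrt.mpr hN
  have key : ∀ i ∈ S.image Prod.fst,
      ((S.filter (fun p => p.1 = i)).card : ℝ) ≤ 22 * Real.sqrt N := by
    intro i hi
    set U : Finset ℤ := (S.filter (fun p => p.1 = i)).image Prod.snd with hU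
    have hUc : (S.filter (fun p => p.1 = i)).card = U.card := by
      rw [hU, Finset.card_image_of_injOn]
      intro p hp p' hp' e
      simp only [Finset.mem_coe, Finset.mem_filter] at hp hp'
      exact Prod.ext (hp.2.trans hp'.2.symm) e
    have hUm : ∀ j ∈ U, (i, j) ∈ S := by
      intro j hj
      simp only [hU, Finset.mem_image, Finset.mem_filter] at hj
      obtain ⟨p, ⟨hp, rfl⟩, rfl⟩ := hj
      exact hp
    obtain ⟨p, hp, hpi⟩ := Finset.mem_image.mp hi
    have hiN : |(i : ℝ)| ≤ 3 * N := hpi ▸ (h p hp).1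
    have h1 := card_slice_add N μ L i hN hiN (U.filter (0 ≤ ·)) (fun j hj => (Finset.mem_filter.mp hj).2)
      fun j hj => (h _ (hUm j (Finset.mem_filter.mp hj).1)).2
    have h2 := card_slice_add N μ L i hN hiN ((U.filter (¬ 0 ≤ ·)).image Neg.neg)
      (fun j hj => by
        obtain ⟨a, ha, rfl⟩ := Finset.mem_image.mp hj
        have := (Finset.mem_filter.mp ha).2
        omega)
      fun j hj => by
        obtain ⟨a, ha, rfl⟩ := Finset.mem_image.mp hj
        push_cast
        rw [bracket_neg_right, bracket_neg_right, abs_neg]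
        exact (h _ (hUm a (Finset.mem_filter.mp ha).1)).2
    rw [Finset.card_image_of_injective _ neg_injective] at h2
    rw [hUc, ← Finset.card_filter_add_card_filter_not (s := U) (0 ≤ ·)]
    push_cast
    linarith
  have him : ((S.image Prod.fst).card : ℝ) ≤ 7 * N := by
    refine (card_le_of_abs_le _ (3 * N) (by linarith) fun i hi => ?_).trans (by linarith)
    obtain ⟨p, hp, rfl⟩ := Finset.mem_image.mp hi
    exact (h p hp).1
  rw [Finset.card_eq_sum_card_image Prod.fst S]
  push_cast
  calc _ ≤ ∑ _i ∈ S.image Prod.fst, 22 * Real.sqrt N := Finset.sum_le_sum key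
    _ = (S.image Prod.fst).card * (22 * Real.sqrt N) := by rw [Finset.sum_const, nsmul_eq_mul]
    _ ≤ 7 * N * (22 * Real.sqrt N) := by gcongr
    _ = _ := by ring

lemma hasDerivAt_bracket (w x : ℝ) :
    HasDerivAt (fun x => bracket x w) (x / bracket x w) x := by
  have h : HasDerivAt (fun x : ℝ => 1 + x ^ 2 + w ^ 2) (2 * x) x := by
    simpa using ((hasDerivAt_pow 2 x).const_add 1).add_const (w ^ 2)
  exact (h.sqrt (by positivity)).congr_deriv (mul_div_mul_left x _ two_ne_zero)

lemma hasDerivAt_div_bracket (w x : ℝ) :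
    HasDerivAt (fun x => x / bracket x w) ((1 + w ^ 2) / bracket x w ^ 3) x := by
  have hp := bracket_pos x w
  refine ((hasDerivAt_id x).div (hasDerivAt_bracket w x) hp.ne').congr_deriv ?_
  have := bracket_sq x w
  simp only [id]
  field_simp
  linear_combination this

lemma div_bracket_mono (w : ℝ) : Monotone fun x => x / bracket x w := by
  refine monotone_of_deriv_nonneg (fun x => (hasDerivAt_div_bracket w x).differentiableAt)
    fun x => ?_
  rw [(hasDerivAt_div_bracket w x).deriv]
  have := bracket_pos x w
  positivity

lemma le_div_bracket_sub (N A x w : ℝ) (hN : 1 ≤ N) (hA : 0 ≤ A)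
    (hx : |x| ≤ 3 * N) (hw : |w| ≤ 3 * N) :
    (1 + w ^ 2) / (216 * N ^ 3) * min A N ≤
      x / bracket x w - (x - A) / bracket (x - A) w := by
  have hA' : 0 ≤ min A N := le_min hA (by linarith)
  have hxx := abs_le.mp hx
  have h1 : (1 + w ^ 2) / (216 * N ^ 3) * (x - (x - min A N)) ≤
      x / bracket x w - (x - min A N) / bracket (x - min A N) w := by
    refine (convex_Icc (x - min A N) x).mul_sub_le_image_sub_of_le_deriv
      (f := fun x => x / bracket x w)
      (fun z _ => (hasDerivAt_div_bracket w z).continuousAt.continuousWithinAt)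
      (fun z _ => (hasDerivAt_div_bracket w z).differentiableAt.differentiableWithinAt)
      (fun z hz => ?_) _ (Set.left_mem_Icc.mpr (by linarith)) _
      (Set.right_mem_Icc.mpr (by linarith)) (by linarith)
    rw [(hasDerivAt_div_bracket w z).deriv]
    rw [interior_Icc] at hz
    have hz1 : |z| ≤ 4 * N :=
      abs_le.mpr ⟨by linarith [hz.1, min_le_right A N], by linarith [hz.2]⟩
    have hb : bracket z w ≤ 6 * N := by
      refine bracket_le (by norm_num) (by linarith) ?_
      have h1 := sq_le_sq' (by linarith [abs_nonneg w]) hw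
      have h2 := sq_le_sq' (by linarith [abs_nonneg z]) hz1
      rw [sq_abs] at h1 h2
      nlinarith
    have hp := bracket_pos z w
    have h3 : bracket z w ^ 3 ≤ 216 * N ^ 3 := by
      calc bracket z w ^ 3 ≤ (6 * N) ^ 3 := by gcongr
        _ = _ := by ring
    gcongr
  have h2 := div_bracket_mono w (show x - A ≤ x - min A N by linarith [min_le_left A N])
  simp only at h2
  rw [sub_sub_cancel] at h1
  linarith

lemma le_bracket_sub_sub (N A x y w : ℝ) (hN : 1 ≤ N) (hA : 0 ≤ A)
    (hx : |x| ≤ 3 * N) (hy : |y| ≤ 3 * N) (hw : |w| ≤ 3 * N) (hxy : x ≤ y) :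
    (1 + w ^ 2) / (216 * N ^ 3) * min A N * (y - x) ≤
      (bracket y w - bracket (y - A) w) - (bracket x w - bracket (x - A) w) := by
  have hd : ∀ z, HasDerivAt (fun z => bracket z w - bracket (z - A) w)
      (z / bracket z w - (z - A) / bracket (z - A) w) z := fun z =>
    (hasDerivAt_bracket w z).sub ((hasDerivAt_bracket w (z - A)).comp_sub_const z A)
  refine (convex_Icc x y).mul_sub_le_image_sub_of_le_deriv
      (f := fun z => bracket z w - bracket (z - A) w)
      (fun z _ => (hd z).continuousAt.continuousWithinAt)
      (fun z _ => (hd z).differentiableAt.differentiableWithinAt)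
      (fun z hz => ?_) _ (Set.left_mem_Icc.mpr hxy) _ (Set.right_mem_Icc.mpr hxy) hxy
  rw [(hd z).deriv]
  rw [interior_Icc] at hz
  refine le_div_bracket_sub N A z w hN hA (abs_le.mpr ⟨?_, ?_⟩) hw
  · linarith [hz.1, (abs_le.mp hx).1]
  · linarith [hz.2, (abs_le.mp hy).2]

lemma card_slice_sub (N μ A w : ℝ) (hN : 1 ≤ N) (hA : 1 ≤ A) (hw : |w| ≤ 3 * N) (U : Finset ℤ)
    (h : ∀ i ∈ U, |(i : ℝ)| ≤ 3 * N ∧ |bracket i w - bracket (i - A) w - μ| ≤ 5) :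
    (U.card : ℝ) ≤ 4320 * N ^ 3 / min A N / (1 + w ^ 2) := by
  have hA' : 1 ≤ min A N := le_min hA hN
  have hw2 : w ^ 2 ≤ 9 * N ^ 2 := by
    have := sq_le_sq' (by linarith [abs_nonneg w]) hw
    rw [sq_abs] at this; linarith
  have h1 := card_le_of_diam U (2160 * N ^ 3 / min A N / (1 + w ^ 2)) (by positivity)
    fun x hx y hy hxy => by
      have hxy' : (x : ℝ) ≤ y := by exact_mod_cast hxy
      have h2 := le_bracket_sub_sub N A x y w hN (by linarith) (h x hx).1 (h y hy).1 hw hxy'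
      have h3 : (1 + w ^ 2) / (216 * N ^ 3) * min A N * ((y : ℝ) - x) ≤ 10 := by
        have := (abs_le.mp (h x hx).2).1
        have := (abs_le.mp (h y hy).2).2
        linarith
      rw [div_div, le_div_iff₀ (by positivity)]
      calc ((y : ℝ) - x) * (min A N * (1 + w ^ 2))
          = (1 + w ^ 2) / (216 * N ^ 3) * min A N * ((y : ℝ) - x) * (216 * N ^ 3) := by
            field_simp
        _ ≤ 10 * (216 * N ^ 3) := by gcongr
        _ = _ := by ring
  have h4 : 1 ≤ 2160 * N ^ 3 / min A N / (1 + w ^ 2) := by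
    rw [div_div, le_div_iff₀ (by positivity), one_mul]
    calc min A N * (1 + w ^ 2) ≤ N * (N ^ 2 + 9 * N ^ 2) := by
          gcongr
          · exact min_le_right _ _
          · nlinarith
      _ ≤ 2160 * N ^ 3 := by nlinarith [pow_pos (show 0 < N by linarith) 3]
  calc (U.card : ℝ) ≤ 2 * (2160 * N ^ 3 / min A N / (1 + w ^ 2)) := by linarith
    _ = _ := by ring

lemma card_sub_le (N μ A : ℝ) (hN : 1 ≤ N) (hA : 1 ≤ A) (S : Finset (ℤ × ℤ))
    (h : ∀ p ∈ S, |(p.1 : ℝ)| ≤ 3 * N ∧ |(p.2 : ℝ)| ≤ 3 * N ∧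
      |bracket p.1 p.2 - bracket (p.1 - A) p.2 - μ| ≤ 5) :
    (S.card : ℝ) ≤ 3200 * (N ^ 2 / Real.sqrt A + N * Real.sqrt N) := by
  classical
  have hA' : 1 ≤ min A N := le_min hA hN
  set E := 4320 * N ^ 3 / min A N with hE
  have hE0 : 0 < E := by positivity
  have key : ∀ j ∈ S.image Prod.snd, ((S.filter (fun p => p.2 = j)).card : ℝ) ≤
      2 * E * (1 / ((Real.sqrt (E / (7 * N))) ^ 2 + (j : ℝ) ^ 2)) := by
    intro j hj
    set U : Finset ℤ := (S.filter (fun p => p.2 = j)).image Prod.fst with hU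
    have hUc : (S.filter (fun p => p.2 = j)).card = U.card := by
      rw [hU, Finset.card_image_of_injOn]
      intro p hp p' hp' e
      simp only [Finset.mem_coe, Finset.mem_filter] at hp hp'
      exact Prod.ext e (hp.2.trans hp'.2.symm)
    have hUm : ∀ i ∈ U, (i, j) ∈ S := by
      intro i hi
      simp only [hU, Finset.mem_image, Finset.mem_filter] at hi
      obtain ⟨p, ⟨hp, rfl⟩, rfl⟩ := hi
      exact hp
    obtain ⟨p, hp, hpj⟩ := Finset.mem_image.mp hj
    have hjN : |(j : ℝ)| ≤ 3 * N := hpj ▸ (h p hp).2.1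
    have h1 := card_slice_sub N μ A j hN hA hjN U fun i hi =>
      ⟨(h _ (hUm i hi)).1, (h _ (hUm i hi)).2.2⟩
    have h2 : (U.card : ℝ) ≤ 7 * N :=
      (card_le_of_abs_le U (3 * N) (by linarith) fun i hi => (h _ (hUm i hi)).1).trans
        (by linarith)
    rw [hUc, Real.sq_sqrt (by positivity), mul_one_div, le_div_iff₀ (by positivity)]
    rw [← hE, le_div_iff₀ (by positivity)] at h1
    have h3 : (U.card : ℝ) * (E / (7 * N)) ≤ E := by
      rw [mul_div_assoc', div_le_iff₀ (by positivity)]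
      nlinarith
    nlinarith [Nat.cast_nonneg (α := ℝ) U.card]
  have hy : 1 ≤ Real.sqrt (E / (7 * N)) := by
    rw [Real.one_le_sqrt, le_div_iff₀ (by positivity), hE, le_div_iff₀ (by positivity)]
    calc 1 * (7 * N) * min A N ≤ 1 * (7 * N) * N := by
          gcongr
          exact min_le_right _ _
      _ ≤ 4320 * N ^ 3 := by nlinarith [pow_pos (show 0 < N by linarith) 2]
  have hsum : (S.card : ℝ) ≤ 2 * E * (8 / Real.sqrt (E / (7 * N))) := by
    rw [Finset.card_eq_sum_card_image Prod.snd S]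
    push_cast
    refine (Finset.sum_le_sum key).trans ?_
    rw [← Finset.mul_sum]
    gcongr
    exact sum_inv_sq_add_sq_le _ _ hy
  have hval : 2 * E * (8 / Real.sqrt (E / (7 * N))) ≤ 3200 * (N ^ 2 / Real.sqrt (min A N)) := by
    have hm : 0 < Real.sqrt (min A N) := Real.sqrt_pos.mpr (by linarith)
    have hm2 : Real.sqrt (min A N) ^ 2 = min A N := Real.sq_sqrt (by linarith)
    have e1 : E = 4320 * N ^ 3 / Real.sqrt (min A N) ^ 2 := by rw [hm2]
    have h24 : 24 * N / Real.sqrt (min A N) ≤ Real.sqrt (E / (7 * N)) := by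
      refine Real.le_sqrt_of_sq_le ?_
      rw [e1, div_pow, div_div, div_le_div_iff₀ (by positivity) (by positivity)]
      have : 0 ≤ N ^ 3 * Real.sqrt (min A N) ^ 2 := by positivity
      nlinarith
    calc 2 * E * (8 / Real.sqrt (E / (7 * N)))
        ≤ 2 * E * (8 / (24 * N / Real.sqrt (min A N))) := by gcongr
      _ = 2880 * (N ^ 2 / Real.sqrt (min A N)) := by
        rw [e1]; field_simp; norm_num
      _ ≤ _ := by gcongr; norm_num
  refine hsum.trans (hval.trans ?_)
  have hs : 1 ≤ Real.sqrt N := Real.one_le_sqrt.mpr hN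
  have hss : Real.sqrt N ^ 2 = N := Real.sq_sqrt (by linarith)
  gcongr
  rcases min_cases A N with ⟨e, _⟩ | ⟨e, _⟩
  · rw [e]
    have : 0 ≤ N * Real.sqrt N := by positivity
    linarith
  · rw [e]
    have : N ^ 2 / Real.sqrt N = N * Real.sqrt N := by
      rw [div_eq_iff (by positivity)]
      linear_combination (-N) * hss
    rw [this]
    have : 0 ≤ N ^ 2 / Real.sqrt A := by positivity
    linarith

lemma card_le_card_image_mul_card_image (S : Finset (Fin 2 → ℤ)) :
    S.card ≤ (S.image (· 0)).card * (S.image (· 1)).card := by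
  rw [← Finset.card_product]
  refine Finset.card_le_card_of_injOn (fun y => (y 0, y 1)) (fun y hy => ?_) fun y _ y' _ e => ?_
  · exact Finset.mem_coe.mpr (Finset.mem_product.mpr
      ⟨Finset.mem_image_of_mem _ hy, Finset.mem_image_of_mem _ hy⟩)
  · simp only [Prod.mk.injEq] at e
    funext i
    fin_cases i
    · exact e.1
    · exact e.2

lemma card_le_of_box (S : Finset (Fin 2 → ℤ)) (c : Fin 2 → ℤ) (R : ℝ) (hR : 0 ≤ R)
    (h : ∀ y ∈ S, ∀ i, |((y i - c i : ℤ) : ℝ)| ≤ R) : (S.card : ℝ) ≤ (2 * R + 1) ^ 2 := by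
  have key : ∀ i, ((S.image (· i)).card : ℝ) ≤ 2 * R + 1 := fun i => by
    refine card_le_of_diam _ (2 * R) (by linarith) fun x hx y hy _ => ?_
    obtain ⟨u, hu, rfl⟩ := Finset.mem_image.mp hx
    obtain ⟨w, hw, rfl⟩ := Finset.mem_image.mp hy
    have h1 := abs_le.mp (h u hu i)
    have h2 := abs_le.mp (h w hw i)
    push_cast at h1 h2
    linarith
  calc (S.card : ℝ) ≤ (S.image (· 0)).card * (S.image (· 1)).card := by
        exact_mod_cast card_le_card_image_mul_card_image S
    _ ≤ (2 * R + 1) * (2 * R + 1) := by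
        gcongr
        · exact key 0
        · exact key 1
    _ = _ := by ring

lemma jb_pos (x : Fin 2 → ℤ) : 0 < jb x := Real.sqrt_pos.mpr (by positivity)

lemma jb_sq (x : Fin 2 → ℤ) : jb x ^ 2 = 1 + (x 0 : ℝ) ^ 2 + (x 1 : ℝ) ^ 2 :=
  Real.sq_sqrt (by positivity)

lemma one_le_jb (x : Fin 2 → ℤ) : 1 ≤ jb x :=
  Real.one_le_sqrt.mpr (by nlinarith [sq_nonneg (x 0 : ℝ), sq_nonneg (x 1 : ℝ)])

lemma abs_le_znorm (x : Fin 2 → ℤ) (i : Fin 2) : |(x i : ℝ)| ≤ znorm x := by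
  refine Real.abs_le_sqrt ?_
  fin_cases i
  · exact le_add_of_nonneg_right (sq_nonneg _)
  · exact le_add_of_nonneg_left (sq_nonneg _)

/-- Number of lattice points in a ball that lie near an ellipse or hyperbola with foci `0`, `a`. -/
lemma card_conic_le (N μ ε₁ ε₂ : ℝ) (hN : 1 ≤ N) (h₁ : ε₁ = -1 ∨ ε₁ = 1)
    (h₂ : ε₂ = -1 ∨ ε₂ = 1) (a : Fin 2 → ℤ) (S : Finset (Fin 2 → ℤ))
    (h : ∀ y ∈ S, znorm y ≤ 2 * N ∧ |ε₁ * jb (a - y) + ε₂ * jb y - μ| ≤ 1) :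
    (S.card : ℝ) ≤ 57600 * (N ^ 2 / Real.sqrt (jb a) + N * Real.sqrt N) := by
  classical
  have hs : 1 ≤ Real.sqrt N := Real.one_le_sqrt.mpr hN
  rcases eq_or_ne a 0 with rfl | ha
  · have h1 := card_le_of_box S 0 (2 * N) (by linarith) fun y hy i => by
      simpa using (abs_le_znorm y i).trans (h y hy).1
    have : jb 0 = 1 := by simp [jb]
    rw [this, Real.sqrt_one, div_one]
    nlinarith [mul_pos (show 0 < N by linarith) (show 0 < Real.sqrt N by linarith)]
  have hL2 : (1 : ℝ) ≤ (a 0 : ℝ) ^ 2 + (a 1 : ℝ) ^ 2 := by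
    have h0 : a 0 ≠ 0 ∨ a 1 ≠ 0 := by
      by_contra! hc
      exact ha (funext fun i => by fin_cases i <;> simp [hc.1, hc.2])
    have : (1 : ℤ) ≤ a 0 ^ 2 + a 1 ^ 2 := by
      rcases h0 with h0 | h0
      · nlinarith [sq_nonneg (a 1), pow_pos (abs_pos.mpr h0) 2, sq_abs (a 0)]
      · nlinarith [sq_nonneg (a 0), pow_pos (abs_pos.mpr h0) 2, sq_abs (a 1)]
    exact_mod_cast this
  set L := Real.sqrt ((a 0 : ℝ) ^ 2 + (a 1 : ℝ) ^ 2) with hLdef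
  have hL : 1 ≤ L := Real.one_le_sqrt.mpr hL2
  have hLsq : L ^ 2 = (a 0 : ℝ) ^ 2 + (a 1 : ℝ) ^ 2 := Real.sq_sqrt (by linarith)
  have hL0 : L ≠ 0 := by linarith
  set P : (Fin 2 → ℤ) → ℝ := fun y => ((a 0 : ℝ) * y 0 + a 1 * y 1) / L with hP
  set Q : (Fin 2 → ℤ) → ℝ := fun y => ((a 0 : ℝ) * y 1 - a 1 * y 0) / L with hQ
  have hPL : ∀ y, P y * L = (a 0 : ℝ) * y 0 + a 1 * y 1 := fun y => by
    simp only [hP]; field_simp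
  have hPQ : ∀ y, P y ^ 2 + Q y ^ 2 = (y 0 : ℝ) ^ 2 + (y 1 : ℝ) ^ 2 := fun y => by
    simp only [hP, hQ]
    rw [div_pow, div_pow, ← add_div, div_eq_iff (by positivity), hLsq]
    ring
  have hPs : ∀ y y', P (y - y') = P y - P y' := fun y y' => by
    simp only [hP, Pi.sub_apply]; push_cast; ring
  have hQs : ∀ y y', Q (y - y') = Q y - Q y' := fun y y' => by
    simp only [hQ, Pi.sub_apply]; push_cast; ring
  have hjb : ∀ y, jb y = bracket (P y) (Q y) := fun y => by
    unfold jb bracket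
    congr 1
    linarith [hPQ y]
  have hjb' : ∀ y, jb (a - y) = bracket (P y - L) (Q y) := fun y => by
    unfold jb bracket
    congr 1
    simp only [Pi.sub_apply]
    push_cast
    linear_combination -hPQ y + 2 * hPL y - hLsq
  set f : (Fin 2 → ℤ) → ℤ × ℤ := fun y => (⌊P y⌋, ⌊Q y⌋) with hf
  have hfl : ∀ x : ℝ, |x - ⌊x⌋| ≤ 1 := fun x =>
    abs_le.mpr ⟨by linarith [Int.floor_le x], by linarith [Int.lt_floor_add_one x]⟩
  have hfib : ∀ b ∈ S.image f, (S.filter (f · = b)).card ≤ 9 := by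
    intro b hb
    obtain ⟨y₀, -, rfl⟩ := Finset.mem_image.mp hb
    have := card_le_of_box (S.filter (f · = f y₀)) y₀ 1 zero_le_one fun y hy => by
      have e := (Finset.mem_filter.mp hy).2
      simp only [hf, Prod.mk.injEq] at e
      have e1 : |P y - P y₀| < 1 := Int.abs_sub_lt_one_of_floor_eq_floor e.1
      have e2 : |Q y - Q y₀| < 1 := Int.abs_sub_lt_one_of_floor_eq_floor e.2
      have e3 := hPQ (y - y₀)
      rw [hPs, hQs] at e3
      have e4 : (P y - P y₀) ^ 2 < 1 := (sq_lt_one_iff_abs_lt_one _).mpr e1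
      have e5 : (Q y - Q y₀) ^ 2 < 1 := (sq_lt_one_iff_abs_lt_one _).mpr e2
      have e6 : (y 0 - y₀ 0) ^ 2 + (y 1 - y₀ 1) ^ 2 < 2 := by
        have : (((y - y₀) 0 : ℤ) : ℝ) ^ 2 + (((y - y₀) 1 : ℤ) : ℝ) ^ 2 < 2 := by linarith
        simp only [Pi.sub_apply] at this
        exact_mod_cast this
      intro i
      have e7 : |y i - y₀ i| ≤ 1 := by
        rw [← sq_le_one_iff_abs_le_one]
        fin_cases i
        · show (y 0 - y₀ 0) ^ 2 ≤ 1
          linarith [sq_nonneg (y 1 - y₀ 1)]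
        · show (y 1 - y₀ 1) ^ 2 ≤ 1
          linarith [sq_nonneg (y 0 - y₀ 0)]
      exact_mod_cast e7
    norm_num at this
    exact_mod_cast this
  have hcard : (S.card : ℝ) ≤ 9 * ((S.image f).card : ℝ) := by
    exact_mod_cast Finset.card_le_mul_card_image S 9 hfib
  have hbox : ∀ y ∈ S, |((⌊P y⌋ : ℤ) : ℝ)| ≤ 3 * N ∧ |((⌊Q y⌋ : ℤ) : ℝ)| ≤ 3 * N := by
    intro y hy
    have hz : (y 0 : ℝ) ^ 2 + (y 1 : ℝ) ^ 2 ≤ (2 * N) ^ 2 :=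
      (Real.sqrt_le_left (by linarith)).mp (h y hy).1
    have hp : |P y| ≤ 2 * N := abs_le_of_sq_le_sq (by nlinarith [hPQ y, sq_nonneg (Q y)])
      (by linarith)
    have hq : |Q y| ≤ 2 * N := abs_le_of_sq_le_sq (by nlinarith [hPQ y, sq_nonneg (P y)])
      (by linarith)
    have hp1 := abs_le.mp hp
    have hq1 := abs_le.mp hq
    have hp2 := abs_le.mp (hfl (P y))
    have hq2 := abs_le.mp (hfl (Q y))
    exact ⟨abs_le.mpr ⟨by linarith, by linarith⟩, abs_le.mpr ⟨by linarith, by linarith⟩⟩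
  have hnear : ∀ y, |jb y - bracket ⌊P y⌋ ⌊Q y⌋| ≤ 2 ∧
      |jb (a - y) - bracket (⌊P y⌋ - L) ⌊Q y⌋| ≤ 2 := by
    intro y
    have hp := hfl (P y)
    have hq := hfl (Q y)
    rw [hjb, hjb']
    refine ⟨(bracket_sub_le _ _ _ _).trans (by linarith),
      (bracket_sub_le _ _ _ _).trans ?_⟩
    rw [sub_sub_sub_cancel_right]
    linarith
  have himage : ((S.image f).card : ℝ) ≤ 3200 * (N ^ 2 / Real.sqrt L + N * Real.sqrt N) := by
    have hadd : ∀ ν : ℝ, (∀ y ∈ S, |jb y + jb (a - y) - ν| ≤ 1) →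
        ((S.image f).card : ℝ) ≤ 3200 * (N ^ 2 / Real.sqrt L + N * Real.sqrt N) := by
      intro ν hν
      refine (card_add_le N ν L hN (S.image f) fun p hp => ?_).trans ?_
      · obtain ⟨y, hy, rfl⟩ := Finset.mem_image.mp hp
        refine ⟨(hbox y hy).1, (hbox y hy).2, ?_⟩
        have h1 := abs_le.mp (hnear y).1
        have h2 := abs_le.mp (hnear y).2
        have h3 := abs_le.mp (hν y hy)
        exact abs_le.mpr ⟨by linarith, by linarith⟩
      · have : 0 ≤ N ^ 2 / Real.sqrt L := by positivity
        have : 0 ≤ N * Real.sqrt N := by positivity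
        linarith
    have hsub : ∀ ν : ℝ, (∀ y ∈ S, |jb y - jb (a - y) - ν| ≤ 1) →
        ((S.image f).card : ℝ) ≤ 3200 * (N ^ 2 / Real.sqrt L + N * Real.sqrt N) := by
      intro ν hν
      refine card_sub_le N ν L hN hL (S.image f) fun p hp => ?_
      obtain ⟨y, hy, rfl⟩ := Finset.mem_image.mp hp
      refine ⟨(hbox y hy).1, (hbox y hy).2, ?_⟩
      have h1 := abs_le.mp (hnear y).1
      have h2 := abs_le.mp (hnear y).2
      have h3 := abs_le.mp (hν y hy)
      exact abs_le.mpr ⟨by linarith, by linarith⟩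
    rcases h₁ with rfl | rfl <;> rcases h₂ with rfl | rfl
    · refine hadd (-μ) fun y hy => ?_
      have := abs_le.mp (h y hy).2
      exact abs_le.mpr ⟨by linarith, by linarith⟩
    · refine hsub μ fun y hy => ?_
      have := abs_le.mp (h y hy).2
      exact abs_le.mpr ⟨by linarith, by linarith⟩
    · refine hsub (-μ) fun y hy => ?_
      have := abs_le.mp (h y hy).2
      exact abs_le.mpr ⟨by linarith, by linarith⟩
    · refine hadd μ fun y hy => ?_
      have := abs_le.mp (h y hy).2
      exact abs_le.mpr ⟨by linarith, by linarith⟩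
  have hja : Real.sqrt (jb a) ≤ 2 * Real.sqrt L := by
    refine Real.sqrt_le_iff.mpr ⟨by positivity, ?_⟩
    rw [mul_pow, Real.sq_sqrt (by linarith)]
    refine abs_le_of_sq_le_sq' ?_ (by linarith) |>.2
    rw [jb_sq]
    nlinarith
  have hdiv : N ^ 2 / Real.sqrt L ≤ 2 * (N ^ 2 / Real.sqrt (jb a)) := by
    have := jb_pos a
    rw [mul_div_assoc', div_le_div_iff₀ (by positivity) (by positivity)]
    nlinarith [sq_nonneg N]
  have : 0 ≤ N * Real.sqrt N := by positivity
  linarith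

lemma sum_range_rpow_neg_le (γ : ℝ) (h0 : 0 ≤ γ) (h1 : γ < 1) (M : ℕ) :
    ∑ k ∈ Finset.range M, ((k : ℝ) + 1) ^ (-γ) ≤ (M : ℝ) ^ (1 - γ) / (1 - γ) := by
  have hγ : 0 < 1 - γ := by linarith
  induction M with
  | zero => simp [Real.zero_rpow hγ.ne']
  | succ k ih =>
    rw [Finset.sum_range_succ]
    have hk : (0 : ℝ) ≤ k := Nat.cast_nonneg k
    have ht : (0 : ℝ) < k + 1 := by linarith
    have hle : (1 : ℝ) / (k + 1) ≤ 1 := by rw [div_le_one ht]; linarith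
    have hb := rpow_one_add_le_one_add_mul_self (s := -(1 / ((k : ℝ) + 1))) (by linarith) hγ.le
      (by linarith)
    have e1 : (k : ℝ) ^ (1 - γ) =
        ((k : ℝ) + 1) ^ (1 - γ) * (1 + -(1 / ((k : ℝ) + 1))) ^ (1 - γ) := by
      rw [← Real.mul_rpow ht.le (by linarith)]
      congr 1
      field_simp
      ring
    have e2 : ((k : ℝ) + 1) ^ (1 - γ) = ((k : ℝ) + 1) * ((k : ℝ) + 1) ^ (-γ) := by
      rw [sub_eq_add_neg, Real.rpow_add ht, Real.rpow_one]
    have e3 : ((k : ℝ) + 1) ^ (1 - γ) * (1 + -(1 / ((k : ℝ) + 1))) ^ (1 - γ) ≤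
        ((k : ℝ) + 1) ^ (1 - γ) * (1 + (1 - γ) * -(1 / ((k : ℝ) + 1))) := by gcongr
    have e4 : ((k : ℝ) + 1) ^ (1 - γ) * (1 + (1 - γ) * -(1 / ((k : ℝ) + 1))) =
        ((k : ℝ) + 1) ^ (1 - γ) - (1 - γ) * ((k : ℝ) + 1) ^ (-γ) := by
      rw [e2]
      field_simp
      ring
    rw [le_div_iff₀ hγ] at ih ⊢
    push_cast
    nlinarith

lemma sum_int_rpow_neg_le (γ : ℝ) (h0 : 0 ≤ γ) (h1 : γ < 1) (U : Finset ℤ) (R : ℝ) (hR : 1 ≤ R)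
    (hU : (U.card : ℝ) ≤ R) (c : ℤ) :
    ∑ i ∈ U, (1 + |((i + c : ℤ) : ℝ)|) ^ (-γ) ≤ (1 + 4 / (1 - γ)) * R ^ (1 - γ) := by
  wlog hc : c = 0 generalizing U c
  · have := this (U.image (· + c)) (by
      rwa [Finset.card_image_of_injective _ (add_left_injective c)]) 0 rfl
    rw [Finset.sum_image fun _ _ _ _ e => add_left_injective c e] at this
    simpa using this
  subst hc
  simp only [add_zero]
  have hγ : 0 < 1 - γ := by linarith
  rw [← Finset.sum_filter_add_sum_filter_not U (fun i => i.natAbs < ⌈R⌉₊)]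
  have hsmall : ∑ i ∈ U.filter (fun i => i.natAbs < ⌈R⌉₊), (1 + |(i : ℝ)|) ^ (-γ) ≤
      4 / (1 - γ) * R ^ (1 - γ) := by
    calc ∑ i ∈ U.filter (fun i => i.natAbs < ⌈R⌉₊), (1 + |(i : ℝ)|) ^ (-γ)
        = ∑ i ∈ U.filter (fun i => i.natAbs < ⌈R⌉₊),
          (fun k : ℕ => ((k : ℝ) + 1) ^ (-γ)) i.natAbs := by
          refine Finset.sum_congr rfl fun j _ => ?_
          simp only [Nat.cast_natAbs, Int.cast_abs, add_comm]
      _ ≤ 2 * ∑ k ∈ (U.filter (fun i => i.natAbs < ⌈R⌉₊)).image Int.natAbs,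
          ((k : ℝ) + 1) ^ (-γ) :=
          sum_natAbs_le _ (fun k : ℕ => ((k : ℝ) + 1) ^ (-γ)) fun k => by positivity
      _ ≤ 2 * ∑ k ∈ Finset.range ⌈R⌉₊, ((k : ℝ) + 1) ^ (-γ) := by
          gcongr
          intro k hk
          obtain ⟨i, hi, rfl⟩ := Finset.mem_image.mp hk
          exact Finset.mem_range.mpr (Finset.mem_filter.mp hi).2
      _ ≤ 2 * ((⌈R⌉₊ : ℝ) ^ (1 - γ) / (1 - γ)) := by
          gcongr
          exact sum_range_rpow_neg_le γ h0 h1 _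
      _ ≤ 2 * ((2 * R ^ (1 - γ)) / (1 - γ)) := by
          gcongr
          calc (⌈R⌉₊ : ℝ) ^ (1 - γ) ≤ (2 * R) ^ (1 - γ) := by
                gcongr
                linarith [Nat.ceil_lt_add_one (show 0 ≤ R by linarith)]
            _ = 2 ^ (1 - γ) * R ^ (1 - γ) := Real.mul_rpow (by norm_num) (by linarith)
            _ ≤ 2 ^ (1 : ℝ) * R ^ (1 - γ) := by
                gcongr
                · norm_num
                · linarith
            _ = _ := by rw [Real.rpow_one]
      _ = _ := by ring
  have hlarge : ∑ i ∈ U.filter (fun i => ¬ i.natAbs < ⌈R⌉₊), (1 + |(i : ℝ)|) ^ (-γ) ≤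
      R ^ (1 - γ) := by
    calc ∑ i ∈ U.filter (fun i => ¬ i.natAbs < ⌈R⌉₊), (1 + |(i : ℝ)|) ^ (-γ)
        ≤ ∑ i ∈ U.filter (fun i => ¬ i.natAbs < ⌈R⌉₊), R ^ (-γ) := by
          refine Finset.sum_le_sum fun i hi => ?_
          refine Real.rpow_le_rpow_of_nonpos (by linarith) ?_ (by linarith)
          have h2 : ⌈R⌉₊ ≤ i.natAbs := not_lt.mp (Finset.mem_filter.mp hi).2
          have h3 : R ≤ (i.natAbs : ℝ) := Nat.ceil_le.mp h2
          rw [Nat.cast_natAbs, Int.cast_abs] at h3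
          linarith
      _ = ((U.filter (fun i => ¬ i.natAbs < ⌈R⌉₊)).card : ℝ) * R ^ (-γ) := by
          rw [Finset.sum_const, nsmul_eq_mul]
      _ ≤ R * R ^ (-γ) := by
          gcongr
          refine le_trans ?_ hU
          exact_mod_cast Finset.card_filter_le _ _
      _ = R ^ (1 - γ) := by
          rw [sub_eq_add_neg, Real.rpow_add (by linarith), Real.rpow_one]
  linarith

lemma exists_sum_int_rpow_neg_le (γ : ℝ) (h1 : 1 < γ) :
    ∃ C : ℝ, 0 ≤ C ∧ ∀ U : Finset ℤ, ∑ i ∈ U, (1 + |(i : ℝ)|) ^ (-γ) ≤ C := by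
  have hs : Summable fun k : ℕ => ((k : ℝ) + 1) ^ (-γ) := by
    have := (summable_nat_add_iff 1).mpr (Real.summable_nat_rpow.mpr (show -γ < -1 by linarith))
    simpa using this
  refine ⟨2 * ∑' k : ℕ, ((k : ℝ) + 1) ^ (-γ),
    mul_nonneg (by norm_num) (tsum_nonneg fun k => by positivity), fun U => ?_⟩
  calc ∑ i ∈ U, (1 + |(i : ℝ)|) ^ (-γ)
      = ∑ i ∈ U, (fun k : ℕ => ((k : ℝ) + 1) ^ (-γ)) i.natAbs := by
        refine Finset.sum_congr rfl fun j _ => ?_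
        simp only [Nat.cast_natAbs, Int.cast_abs, add_comm]
    _ ≤ 2 * ∑ k ∈ U.image Int.natAbs, ((k : ℝ) + 1) ^ (-γ) :=
        sum_natAbs_le _ (fun k : ℕ => ((k : ℝ) + 1) ^ (-γ)) fun k => by positivity
    _ ≤ _ := by
        gcongr
        exact hs.sum_le_tsum _ fun k _ => by positivity

lemma one_add_abs_le_jb (x : Fin 2 → ℤ) (i : Fin 2) : (1 + |(x i : ℝ)|) / 2 ≤ jb x := by
  have h1 := one_le_jb x
  have h2 : |(x i : ℝ)| ≤ jb x := by
    refine Real.abs_le_sqrt ?_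
    fin_cases i
    · show (x 0 : ℝ) ^ 2 ≤ 1 + (x 0 : ℝ) ^ 2 + (x 1 : ℝ) ^ 2
      nlinarith [sq_nonneg (x 1 : ℝ)]
    · show (x 1 : ℝ) ^ 2 ≤ 1 + (x 0 : ℝ) ^ 2 + (x 1 : ℝ) ^ 2
      nlinarith [sq_nonneg (x 0 : ℝ)]
  linarith

lemma sum_jb_rpow_le_mul (γ : ℝ) (h0 : 0 ≤ γ) (S : Finset (Fin 2 → ℤ)) (c : Fin 2 → ℤ) :
    ∑ y ∈ S, jb (y + c) ^ (-(2 * γ)) ≤ 4 ^ γ *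
      ((∑ i ∈ S.image (· 0), (1 + |((i + c 0 : ℤ) : ℝ)|) ^ (-γ)) *
        ∑ i ∈ S.image (· 1), (1 + |((i + c 1 : ℤ) : ℝ)|) ^ (-γ)) := by
  classical
  rw [Finset.sum_mul_sum, ← Finset.sum_product', Finset.mul_sum]
  have hinj : Function.Injective fun y : Fin 2 → ℤ => (y 0, y 1) := fun y y' e => by
    simp only [Prod.mk.injEq] at e
    funext i
    fin_cases i
    · exact e.1
    · exact e.2
  have hterm : ∀ y ∈ S, jb (y + c) ^ (-(2 * γ)) ≤ 4 ^ γ *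
      ((1 + |((y 0 + c 0 : ℤ) : ℝ)|) ^ (-γ) * (1 + |((y 1 + c 1 : ℤ) : ℝ)|) ^ (-γ)) := by
    intro y _
    have key : ∀ i : Fin 2, jb (y + c) ^ (-γ) ≤ 2 ^ γ * (1 + |((y i + c i : ℤ) : ℝ)|) ^ (-γ) := by
      intro i
      calc jb (y + c) ^ (-γ) ≤ ((1 + |((y i + c i : ℤ) : ℝ)|) / 2) ^ (-γ) :=
            Real.rpow_le_rpow_of_nonpos (by positivity) (one_add_abs_le_jb (y + c) i) (by linarith)
        _ = _ := by
            rw [Real.div_rpow (by positivity) (by norm_num), Real.rpow_neg (by norm_num : (0:ℝ) ≤ 2),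
              div_inv_eq_mul, mul_comm]
    have hp := jb_pos (y + c)
    calc jb (y + c) ^ (-(2 * γ)) = jb (y + c) ^ (-γ) * jb (y + c) ^ (-γ) := by
          rw [← Real.rpow_add hp]; congr 1; ring
      _ ≤ (2 ^ γ * (1 + |((y 0 + c 0 : ℤ) : ℝ)|) ^ (-γ)) *
          (2 ^ γ * (1 + |((y 1 + c 1 : ℤ) : ℝ)|) ^ (-γ)) := by
          gcongr
          · exact key 0
          · exact key 1
      _ = _ := by
          rw [show (4 : ℝ) = 2 * 2 by norm_num, Real.mul_rpow (by norm_num) (by norm_num)]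
          ring
  refine (Finset.sum_le_sum hterm).trans ?_
  rw [← Finset.sum_image (s := S) (g := fun y : Fin 2 → ℤ => (y 0, y 1))
    (f := fun p : ℤ × ℤ => (4 : ℝ) ^ γ *
      ((1 + |((p.1 + c 0 : ℤ) : ℝ)|) ^ (-γ) * (1 + |((p.2 + c 1 : ℤ) : ℝ)|) ^ (-γ)))
    (fun _ _ _ _ e => hinj e)]
  refine Finset.sum_le_sum_of_subset_of_nonneg (fun p hp => ?_) fun _ _ _ => by positivity
  obtain ⟨y, hy, rfl⟩ := Finset.mem_image.mp hp
  exact Finset.mem_product.mpr ⟨Finset.mem_image_of_mem _ hy, Finset.mem_image_of_mem _ hy⟩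

lemma exists_sum_jb_rpow_neg_le (δ : ℝ) (hδ : 0 < δ) :
    ∃ C : ℝ, 0 ≤ C ∧ ∀ S : Finset (Fin 2 → ℤ), ∑ y ∈ S, jb y ^ (-2 - δ) ≤ C := by
  obtain ⟨C, hC, h⟩ := exists_sum_int_rpow_neg_le (1 + δ / 2) (by linarith)
  refine ⟨4 ^ (1 + δ / 2) * (C * C), by positivity, fun S => ?_⟩
  have h1 := sum_jb_rpow_le_mul (1 + δ / 2) (by linarith) S 0
  simp only [Pi.zero_apply, add_zero] at h1
  rw [show -(2 * (1 + δ / 2)) = -2 - δ by ring] at h1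
  refine h1.trans ?_
  gcongr
  · exact h _
  · exact h _

lemma exists_sum_jb_rpow_ball_le (β : ℝ) (h0 : 0 ≤ β) (h2 : β < 2) :
    ∃ C : ℝ, 0 ≤ C ∧ ∀ (N : ℝ) (S : Finset (Fin 2 → ℤ)) (c : Fin 2 → ℤ), 1 ≤ N →
      (∀ y ∈ S, znorm y ≤ 2 * N) → ∑ y ∈ S, jb (y + c) ^ (-β) ≤ C * N ^ (2 - β) := by
  have hβ : 0 < 1 - β / 2 := by linarith
  set K := 1 + 4 / (1 - β / 2) with hK
  have hK0 : 0 ≤ K := by positivity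
  refine ⟨4 ^ (β / 2) * (K * 5 ^ (1 - β / 2)) ^ 2, by positivity, fun N S c hN hS => ?_⟩
  have h1 := sum_jb_rpow_le_mul (β / 2) (by linarith) S c
  rw [show -(2 * (β / 2)) = -β by ring] at h1
  have hcard : ∀ i, ((S.image (· i)).card : ℝ) ≤ 5 * N := fun i => by
    refine (card_le_of_abs_le _ (2 * N) (by linarith) fun x hx => ?_).trans (by linarith)
    obtain ⟨y, hy, rfl⟩ := Finset.mem_image.mp hx
    exact (abs_le_znorm y i).trans (hS y hy)
  have key : ∀ i, ∑ x ∈ S.image (· i), (1 + |((x + c i : ℤ) : ℝ)|) ^ (-(β / 2)) ≤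
      K * (5 * N) ^ (1 - β / 2) := fun i =>
    sum_int_rpow_neg_le (β / 2) (by linarith) (by linarith) _ _ (by linarith) (hcard i) _
  calc _ ≤ _ := h1
    _ ≤ 4 ^ (β / 2) * ((K * (5 * N) ^ (1 - β / 2)) * (K * (5 * N) ^ (1 - β / 2))) := by
        gcongr
        · exact key 0
        · exact key 1
    _ = _ := by
        rw [Real.mul_rpow (by norm_num) (by linarith),
          show 2 - β = (1 - β / 2) + (1 - β / 2) by ring, Real.rpow_add (by linarith)]
        ring

lemma jb_neg (x : Fin 2 → ℤ) : jb (-x) = jb x := by simp [jb]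

lemma znorm_le_jb (x : Fin 2 → ℤ) : znorm x ≤ jb x :=
  Real.sqrt_le_sqrt (by linarith)

lemma jb_le_two_mul (n w : Fin 2 → ℤ) : jb n ≤ 2 * (jb (n + w) * jb w) := by
  have h1 := jb_pos (n + w)
  have h2 := jb_pos w
  refine abs_le_of_sq_le_sq' ?_ (by positivity) |>.2
  rw [mul_pow, mul_pow, jb_sq, jb_sq, jb_sq]
  simp only [Pi.add_apply]
  push_cast
  nlinarith [sq_nonneg ((n 0 : ℝ) + 2 * w 0), sq_nonneg ((n 1 : ℝ) + 2 * w 1),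
    mul_nonneg (add_nonneg (sq_nonneg ((n 0 : ℝ) + w 0)) (sq_nonneg ((n 1 : ℝ) + w 1)))
      (add_nonneg (sq_nonneg (w 0 : ℝ)) (sq_nonneg (w 1 : ℝ)))]

lemma jb_rpow_le_of_ann {N e : ℝ} (hN : 1 ≤ N) (he : e ≤ 0) {x : Fin 2 → ℤ} (hx : ann N x) :
    jb x ^ e ≤ 2 ^ (-e) * N ^ e := by
  calc jb x ^ e ≤ (N / 2) ^ e :=
        Real.rpow_le_rpow_of_nonpos (by linarith) (hx.1.trans (znorm_le_jb x)) he
    _ = _ := by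
        rw [Real.div_rpow (by linarith) (by norm_num), Real.rpow_neg (by norm_num), div_eq_mul_inv,
          mul_comm]

lemma exists_sum_ann_le (α s θ : ℝ) (hθ : 3 * θ = -(2 * α + 2 * s)) (hα : 0 < α)
    (hs0 : -1 < s) (hs1 : s < -α) :
    ∃ C : ℝ, 0 ≤ C ∧ ∀ (N : ℝ) (n : Fin 2 → ℤ) (S : Finset (Fin 2 → ℤ)), 1 ≤ N →
      (∀ w ∈ S, ann N w) →
      ∑ w ∈ S, jb w ^ (-2 + 2 * α) * jb (n + w) ^ (2 * s) ≤ C * N ^ (-θ) * jb n ^ (-θ) := by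
  obtain ⟨C, hC, h⟩ := exists_sum_jb_rpow_ball_le (-(2 * s + θ)) (by linarith) (by linarith)
  set e := -2 + 2 * α + θ with he
  have he0 : e ≤ 0 := by linarith
  refine ⟨2 ^ θ * 2 ^ (-e) * C, by positivity, fun N n S hN hS => ?_⟩
  have hn := jb_pos n
  have hterm : ∀ w ∈ S, jb w ^ (-2 + 2 * α) * jb (n + w) ^ (2 * s) ≤
      2 ^ θ * jb n ^ (-θ) * (2 ^ (-e) * N ^ e) * jb (w + n) ^ (- -(2 * s + θ)) := by
    intro w hw
    have hw0 := jb_pos w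
    have hnw := jb_pos (n + w)
    have h1 : jb n ^ θ ≤ 2 ^ θ * (jb (n + w) ^ θ * jb w ^ θ) := by
      rw [← Real.mul_rpow hnw.le hw0.le, ← Real.mul_rpow (by norm_num) (by positivity)]
      exact Real.rpow_le_rpow hn.le (jb_le_two_mul n w) (by linarith)
    have h2 : jb (n + w) ^ (-θ) ≤ 2 ^ θ * jb w ^ θ * jb n ^ (-θ) := by
      rw [Real.rpow_neg hnw.le, Real.rpow_neg hn.le, ← div_eq_mul_inv,
        le_div_iff₀ (by positivity), inv_mul_le_iff₀ (by positivity)]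
      linarith
    calc jb w ^ (-2 + 2 * α) * jb (n + w) ^ (2 * s)
        = jb w ^ (-2 + 2 * α) * (jb (n + w) ^ (-θ) * jb (n + w) ^ (2 * s + θ)) := by
          rw [← Real.rpow_add hnw]; congr 2; ring
      _ ≤ jb w ^ (-2 + 2 * α) * (2 ^ θ * jb w ^ θ * jb n ^ (-θ) * jb (n + w) ^ (2 * s + θ)) := by
          gcongr
      _ = 2 ^ θ * jb n ^ (-θ) * jb w ^ e * jb (w + n) ^ (- -(2 * s + θ)) := by
          rw [he, Real.rpow_add hw0 _ θ, neg_neg, add_comm w n]; ring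
      _ ≤ _ := by
          gcongr
          · exact Real.rpow_nonneg (jb_pos _).le _
          · exact jb_rpow_le_of_ann hN he0 (hS w hw)
  refine (Finset.sum_le_sum hterm).trans ?_
  rw [← Finset.mul_sum]
  calc _ ≤ 2 ^ θ * jb n ^ (-θ) * (2 ^ (-e) * N ^ e) * (C * N ^ (2 - -(2 * s + θ))) := by
        gcongr
        exact h N S n hN fun w hw => (hS w hw).2
    _ = 2 ^ θ * 2 ^ (-e) * C * (N ^ e * N ^ (2 - -(2 * s + θ))) * jb n ^ (-θ) := by ring
    _ = _ := by
        rw [← Real.rpow_add (show 0 < N by linarith),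
          show e + (2 - -(2 * s + θ)) = -θ by linarith]

/-- Cubic sum estimate, with the frequency `N₁` of `x` fixed by the resonance constraint. -/
lemma exists_cubic_sum_le (e δ : ℝ) (he : e ≤ 0) (hδ : 0 < δ) :
    ∃ C : ℝ, 0 ≤ C ∧ ∀ (N₁ N₂ N₃ σ σ₁ σ₂ σ₃ m : ℝ), 1 ≤ N₁ → 1 ≤ N₂ → 1 ≤ N₃ →
      (σ₁ = -1 ∨ σ₁ = 1) → (σ₂ = -1 ∨ σ₂ = 1) →
      ∀ {ι : Type} (T : Finset ι) (x y z : ι → Fin 2 → ℤ),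
      Set.InjOn (fun i => (x i, y i, z i)) T →
      (∀ i ∈ T, ann N₁ (x i) ∧ ann N₂ (y i) ∧ ann N₃ (z i) ∧
        |phase σ σ₁ σ₂ σ₃ (x i) (y i) (z i) - m| ≤ 1) →
      ∑ i ∈ T, jb (x i) ^ e * jb (y i) ^ e * jb (z i) ^ e * jb (x i + y i + z i) ^ (-2 - δ) ≤
        C * (N₁ ^ e * N₂ ^ e * N₃ ^ e *
          (N₂ ^ (2 : ℝ) * N₃ ^ (3 / 2 : ℝ) + N₂ ^ (3 / 2 : ℝ) * N₃ ^ (2 : ℝ))) := by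
  classical
  obtain ⟨A, hA, hsumA⟩ := exists_sum_jb_rpow_neg_le δ hδ
  obtain ⟨B, hB, hsumB⟩ := exists_sum_jb_rpow_ball_le (1 / 2) (by norm_num) (by norm_num)
  refine ⟨(2 ^ (-e)) ^ 3 * (57600 * A * (B + 25)), by positivity, ?_⟩
  intro N₁ N₂ N₃ σ σ₁ σ₂ σ₃ m hN₁ hN₂ hN₃ hσ₁ hσ₂ ι T x y z hinj hT
  set g : ι → (Fin 2 → ℤ) × (Fin 2 → ℤ) := fun i => (x i + y i + z i, z i) with hg
  have hterm : ∀ i ∈ T,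
      jb (x i) ^ e * jb (y i) ^ e * jb (z i) ^ e * jb (x i + y i + z i) ^ (-2 - δ) ≤
        (2 ^ (-e)) ^ 3 * (N₁ ^ e * N₂ ^ e * N₃ ^ e) * jb (g i).1 ^ (-2 - δ) := by
    intro i hi
    obtain ⟨hx, hy, hz, -⟩ := hT i hi
    have := jb_pos (x i)
    have := jb_pos (y i)
    have := jb_pos (z i)
    have := jb_pos (x i + y i + z i)
    calc _ ≤ (2 ^ (-e) * N₁ ^ e) * (2 ^ (-e) * N₂ ^ e) * (2 ^ (-e) * N₃ ^ e) *
          jb (x i + y i + z i) ^ (-2 - δ) := by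
          gcongr
          · exact jb_rpow_le_of_ann hN₁ he hx
          · exact jb_rpow_le_of_ann hN₂ he hy
          · exact jb_rpow_le_of_ann hN₃ he hz
      _ = _ := by simp only [hg]; ring
  have hcount : ∀ b ∈ T.image g, ((T.filter (fun i => g i = b)).card : ℝ) ≤
      57600 * (N₂ ^ (2 : ℝ) * jb (b.2 + -b.1) ^ (-(1 / 2) : ℝ) + N₂ ^ (3 / 2 : ℝ)) := by
    rintro ⟨n, w⟩ -
    have hc : (T.filter (fun i => g i = (n, w))).card =
        ((T.filter (fun i => g i = (n, w))).image y).card := by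
      rw [Finset.card_image_of_injOn]
      intro i hi j hj hij
      simp only [Finset.mem_coe, Finset.mem_filter, hg, Prod.mk.injEq] at hi hj
      refine hinj hi.1 hj.1 ?_
      have hz : z i = z j := hi.2.2.trans hj.2.2.symm
      have hx : x i = x j := by
        have := hi.2.1.trans hj.2.1.symm
        rw [hz, hij] at this
        exact add_right_cancel (add_right_cancel this)
      simp only [hx, hij, hz]
    rw [hc]
    refine (card_conic_le N₂ (m - σ * jb n - σ₃ * jb w) σ₁ σ₂ hN₂ hσ₁ hσ₂ (n - w) _
      fun v hv => ?_).trans ?_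
    · obtain ⟨i, hi, rfl⟩ := Finset.mem_image.mp hv
      simp only [Finset.mem_filter, hg, Prod.mk.injEq] at hi
      obtain ⟨hiT, rfl, rfl⟩ := hi
      obtain ⟨-, hy, -, hph⟩ := hT i hiT
      refine ⟨hy.2, ?_⟩
      rw [show x i + y i + z i - z i - y i = x i by abel]
      convert hph using 2
      unfold phase
      ring
    · have e1 : N₂ ^ 2 / Real.sqrt (jb (n - w)) =
          N₂ ^ (2 : ℝ) * jb (w + -n) ^ (-(1 / 2) : ℝ) := by
        rw [show w + -n = -(n - w) by abel, jb_neg, Real.rpow_neg (jb_pos _).le,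
          Real.sqrt_eq_rpow, Real.rpow_two, div_eq_mul_inv]
      have e2 : N₂ * Real.sqrt N₂ = N₂ ^ (3 / 2 : ℝ) := by
        rw [show (3 / 2 : ℝ) = 1 + 1 / 2 by norm_num, Real.rpow_add (by linarith), Real.rpow_one,
          Real.sqrt_eq_rpow]
      rw [e1, e2]
  set X := T.image fun i => x i + y i + z i with hX
  set Z := T.image z with hZ
  have hZann : ∀ w ∈ Z, znorm w ≤ 2 * N₃ := by
    intro w hw
    obtain ⟨i, hi, rfl⟩ := Finset.mem_image.mp hw
    exact (hT i hi).2.2.1.2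
  have hZcard : (Z.card : ℝ) ≤ 25 * N₃ ^ (2 : ℝ) := by
    rw [Real.rpow_two]
    refine (card_le_of_box Z 0 (2 * N₃) (by linarith) fun w hw i => ?_).trans (by nlinarith)
    simpa using (abs_le_znorm w i).trans (hZann w hw)
  have hinner : ∀ n, ∑ w ∈ Z, 57600 * (N₂ ^ (2 : ℝ) * jb (w + -n) ^ (-(1 / 2) : ℝ) +
      N₂ ^ (3 / 2 : ℝ)) ≤ 57600 * (B + 25) *
        (N₂ ^ (2 : ℝ) * N₃ ^ (3 / 2 : ℝ) + N₂ ^ (3 / 2 : ℝ) * N₃ ^ (2 : ℝ)) := by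
    intro n
    rw [← Finset.mul_sum, Finset.sum_add_distrib, ← Finset.mul_sum, Finset.sum_const,
      nsmul_eq_mul]
    have h1 := hsumB N₃ Z (-n) hN₃ hZann
    rw [show (2 - 1 / 2 : ℝ) = 3 / 2 by norm_num] at h1
    calc _ ≤ 57600 * (N₂ ^ (2 : ℝ) * (B * N₃ ^ (3 / 2 : ℝ)) +
          25 * N₃ ^ (2 : ℝ) * N₂ ^ (3 / 2 : ℝ)) := by gcongr
      _ ≤ _ := by
        have p1 : 0 ≤ N₂ ^ (2 : ℝ) * N₃ ^ (3 / 2 : ℝ) := by positivity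
        have p2 : 0 ≤ N₂ ^ (3 / 2 : ℝ) * N₃ ^ (2 : ℝ) := by positivity
        nlinarith [mul_nonneg hB p2]
  have hsum : ∑ i ∈ T, jb (g i).1 ^ (-2 - δ) ≤ 57600 * A * (B + 25) *
      (N₂ ^ (2 : ℝ) * N₃ ^ (3 / 2 : ℝ) + N₂ ^ (3 / 2 : ℝ) * N₃ ^ (2 : ℝ)) := by
    rw [Finset.sum_comp (fun b : (Fin 2 → ℤ) × (Fin 2 → ℤ) => jb b.1 ^ (-2 - δ)) g]
    have hnn : ∀ b : (Fin 2 → ℤ) × (Fin 2 → ℤ),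
        0 ≤ 57600 * (N₂ ^ (2 : ℝ) * jb (b.2 + -b.1) ^ (-(1 / 2) : ℝ) + N₂ ^ (3 / 2 : ℝ)) *
          jb b.1 ^ (-2 - δ) := fun b => by
      have := jb_pos b.1
      have := jb_pos (b.2 + -b.1)
      positivity
    calc _ ≤ ∑ b ∈ T.image g, 57600 * (N₂ ^ (2 : ℝ) * jb (b.2 + -b.1) ^ (-(1 / 2) : ℝ) +
          N₂ ^ (3 / 2 : ℝ)) * jb b.1 ^ (-2 - δ) := by
          refine Finset.sum_le_sum fun b hb => ?_
          rw [nsmul_eq_mul]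
          exact mul_le_mul_of_nonneg_right (hcount b hb) (Real.rpow_nonneg (jb_pos _).le _)
      _ ≤ ∑ b ∈ X ×ˢ Z, 57600 * (N₂ ^ (2 : ℝ) * jb (b.2 + -b.1) ^ (-(1 / 2) : ℝ) +
          N₂ ^ (3 / 2 : ℝ)) * jb b.1 ^ (-2 - δ) := by
          refine Finset.sum_le_sum_of_subset_of_nonneg (fun b hb => ?_) fun b _ _ => hnn b
          obtain ⟨i, hi, rfl⟩ := Finset.mem_image.mp hb
          exact Finset.mem_product.mpr ⟨Finset.mem_image_of_mem _ hi, Finset.mem_image_of_mem _ hi⟩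
      _ = ∑ n ∈ X, (∑ w ∈ Z, 57600 * (N₂ ^ (2 : ℝ) * jb (w + -n) ^ (-(1 / 2) : ℝ) +
          N₂ ^ (3 / 2 : ℝ))) * jb n ^ (-2 - δ) := by
          rw [Finset.sum_product]
          refine Finset.sum_congr rfl fun n _ => ?_
          rw [Finset.sum_mul]
      _ ≤ ∑ n ∈ X, 57600 * (B + 25) *
          (N₂ ^ (2 : ℝ) * N₃ ^ (3 / 2 : ℝ) + N₂ ^ (3 / 2 : ℝ) * N₃ ^ (2 : ℝ)) *
          jb n ^ (-2 - δ) := by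
          refine Finset.sum_le_sum fun n _ => ?_
          exact mul_le_mul_of_nonneg_right (hinner n) (Real.rpow_nonneg (jb_pos _).le _)
      _ = 57600 * (B + 25) *
          (N₂ ^ (2 : ℝ) * N₃ ^ (3 / 2 : ℝ) + N₂ ^ (3 / 2 : ℝ) * N₃ ^ (2 : ℝ)) *
          ∑ n ∈ X, jb n ^ (-2 - δ) := by rw [Finset.mul_sum]
      _ ≤ 57600 * (B + 25) *
          (N₂ ^ (2 : ℝ) * N₃ ^ (3 / 2 : ℝ) + N₂ ^ (3 / 2 : ℝ) * N₃ ^ (2 : ℝ)) * A := by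
          gcongr
          exact hsumA X
      _ = _ := by ring
  calc _ ≤ _ := Finset.sum_le_sum hterm
    _ = (2 ^ (-e)) ^ 3 * (N₁ ^ e * N₂ ^ e * N₃ ^ e) * ∑ i ∈ T, jb (g i).1 ^ (-2 - δ) := by
        rw [Finset.mul_sum]
    _ ≤ (2 ^ (-e)) ^ 3 * (N₁ ^ e * N₂ ^ e * N₃ ^ e) * (57600 * A * (B + 25) *
      (N₂ ^ (2 : ℝ) * N₃ ^ (3 / 2 : ℝ) + N₂ ^ (3 / 2 : ℝ) * N₃ ^ (2 : ℝ))) := by gcongr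
    _ = _ := by ring

lemma rpow_mul_rpow_mul_rpow_le (α N₁ N₂ N₃ : ℝ) (hα : 0 < α) (hN₂ : 1 ≤ N₂) (hN₃ : 1 ≤ N₃)
    (h₂ : N₂ ≤ N₁) (h₃ : N₃ ≤ N₁) :
    N₁ ^ (-2 + 2 * α) * N₂ ^ (-2 + 2 * α) * N₃ ^ (-2 + 2 * α) *
      (N₂ ^ (2 : ℝ) * N₃ ^ (3 / 2 : ℝ)) ≤ N₁ ^ (-2 * sAlpha α) := by
  have p1 : 0 < N₁ := by linarith
  have p2 : 0 < N₂ := by linarith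
  have p3 : 0 < N₃ := by linarith
  have h3 : N₁ ^ (-2 + 2 * α) * N₁ ^ (2 * α) * N₃ ^ (-(1 / 2) + 2 * α) ≤
      N₁ ^ (-2 * sAlpha α) := by
    unfold sAlpha
    split_ifs with h
    · calc _ ≤ N₁ ^ (-2 + 2 * α) * N₁ ^ (2 * α) * 1 := by
            gcongr
            exact Real.rpow_le_one_of_one_le_of_nonpos hN₃ (by linarith)
        _ = _ := by
            rw [mul_one, ← Real.rpow_add p1]; congr 1; ring
    · calc _ ≤ N₁ ^ (-2 + 2 * α) * N₁ ^ (2 * α) * N₁ ^ (-(1 / 2) + 2 * α) := by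
            gcongr
            linarith
        _ = _ := by
            rw [← Real.rpow_add p1, ← Real.rpow_add p1]; congr 1; ring
  calc _ = N₁ ^ (-2 + 2 * α) * (N₂ ^ (-2 + 2 * α) * N₂ ^ (2 : ℝ)) *
        (N₃ ^ (-2 + 2 * α) * N₃ ^ (3 / 2 : ℝ)) := by ring
    _ = N₁ ^ (-2 + 2 * α) * N₂ ^ (2 * α) * N₃ ^ (-(1 / 2) + 2 * α) := by
        rw [← Real.rpow_add p2, ← Real.rpow_add p3]
        congr 2
        · congr 1; ring
        · ring
    _ ≤ N₁ ^ (-2 + 2 * α) * N₁ ^ (2 * α) * N₃ ^ (-(1 / 2) + 2 * α) := by gcongr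
    _ ≤ _ := h3

/-- Cubic sum estimate in terms of the largest frequency. -/
lemma exists_cubic_sum_le_max (α δ : ℝ) (hα0 : 0 < α) (hα1 : α < 5 / 12) (hδ : 0 < δ) :
    ∃ C : ℝ, 0 ≤ C ∧ ∀ (N₁ N₂ N₃ σ σ₁ σ₂ σ₃ m : ℝ), 1 ≤ N₁ → 1 ≤ N₂ → 1 ≤ N₃ →
      (σ₁ = -1 ∨ σ₁ = 1) → (σ₂ = -1 ∨ σ₂ = 1) → (σ₃ = -1 ∨ σ₃ = 1) →
      ∀ {ι : Type} (T : Finset ι) (x y z : ι → Fin 2 → ℤ),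
      Set.InjOn (fun i => (x i, y i, z i)) T →
      (∀ i ∈ T, ann N₁ (x i) ∧ ann N₂ (y i) ∧ ann N₃ (z i) ∧
        |phase σ σ₁ σ₂ σ₃ (x i) (y i) (z i) - m| ≤ 1) →
      ∑ i ∈ T, jb (x i) ^ (-2 + 2 * α) * jb (y i) ^ (-2 + 2 * α) * jb (z i) ^ (-2 + 2 * α) *
        jb (x i + y i + z i) ^ (-2 - δ) ≤ C * (max N₁ (max N₂ N₃)) ^ (-2 * sAlpha α) := by
  obtain ⟨C, hC, h⟩ := exists_cubic_sum_le (-2 + 2 * α) δ (by linarith) hδ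
  refine ⟨2 * C, by positivity, ?_⟩
  have hmain : ∀ (N₁ N₂ N₃ σ σ₁ σ₂ σ₃ m : ℝ), 1 ≤ N₂ → 1 ≤ N₃ → N₂ ≤ N₁ → N₃ ≤ N₁ →
      (σ₁ = -1 ∨ σ₁ = 1) → (σ₂ = -1 ∨ σ₂ = 1) →
      ∀ {ι : Type} (T : Finset ι) (x y z : ι → Fin 2 → ℤ),
      Set.InjOn (fun i => (x i, y i, z i)) T →
      (∀ i ∈ T, ann N₁ (x i) ∧ ann N₂ (y i) ∧ ann N₃ (z i) ∧
        |phase σ σ₁ σ₂ σ₃ (x i) (y i) (z i) - m| ≤ 1) →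
      ∑ i ∈ T, jb (x i) ^ (-2 + 2 * α) * jb (y i) ^ (-2 + 2 * α) * jb (z i) ^ (-2 + 2 * α) *
        jb (x i + y i + z i) ^ (-2 - δ) ≤ 2 * C * N₁ ^ (-2 * sAlpha α) := by
    intro N₁ N₂ N₃ σ σ₁ σ₂ σ₃ m hN₂ hN₃ h₂ h₃ hσ₁ hσ₂ ι T x y z hinj hT
    refine (h N₁ N₂ N₃ σ σ₁ σ₂ σ₃ m (by linarith) hN₂ hN₃ hσ₁ hσ₂ T x y z hinj hT).trans ?_
    have b1 := rpow_mul_rpow_mul_rpow_le α N₁ N₂ N₃ hα0 hN₂ hN₃ h₂ h₃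
    have b2 := rpow_mul_rpow_mul_rpow_le α N₁ N₃ N₂ hα0 hN₃ hN₂ h₃ h₂
    have b3 := mul_le_mul_of_nonneg_left (add_le_add b1 b2) hC
    linarith
  intro N₁ N₂ N₃ σ σ₁ σ₂ σ₃ m hN₁ hN₂ hN₃ hσ₁ hσ₂ hσ₃ ι T x y z hinj hT
  by_cases c1 : max N₂ N₃ ≤ N₁
  · rw [max_eq_left c1]
    exact hmain N₁ N₂ N₃ σ σ₁ σ₂ σ₃ m hN₂ hN₃ ((le_max_left _ _).trans c1)
      ((le_max_right _ _).trans c1) hσ₁ hσ₂ T x y z hinj hT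
  rw [not_le] at c1
  rw [max_eq_right c1.le]
  rcases le_total N₃ N₂ with c2 | c2
  · rw [max_eq_left c2] at c1 ⊢
    refine le_trans (le_of_eq (Finset.sum_congr rfl fun i _ => ?_))
      (hmain N₂ N₁ N₃ σ σ₂ σ₁ σ₃ m hN₁ hN₃ c1.le c2 hσ₂ hσ₁ T y x z ?_ ?_)
    · rw [add_comm (y i) (x i)]; ring
    · intro i hi j hj hij
      simp only [Prod.mk.injEq] at hij
      exact hinj hi hj (by simp only [hij])
    · intro i hi
      obtain ⟨a, b, c, d⟩ := hT i hi
      refine ⟨b, a, c, ?_⟩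
      convert d using 2
      unfold phase
      rw [add_comm (y i) (x i)]
      ring
  · rw [max_eq_right c2] at c1 ⊢
    refine le_trans (le_of_eq (Finset.sum_congr rfl fun i _ => ?_))
      (hmain N₃ N₂ N₁ σ σ₃ σ₂ σ₁ m hN₂ hN₁ c2 c1.le hσ₃ hσ₂ T z y x ?_ ?_)
    · rw [show z i + y i + x i = x i + y i + z i by abel]; ring
    · intro i hi j hj hij
      simp only [Prod.mk.injEq] at hij
      exact hinj hi hj (by simp only [hij])
    · intro i hi
      obtain ⟨a, b, c, d⟩ := hT i hi
      refine ⟨c, b, a, ?_⟩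
      convert d using 2
      unfold phase
      rw [show z i + y i + x i = x i + y i + z i by abel]
      ring

/-- quartic non-resonance sum estimate: for `0 < α < 5/12` and `−1 < s < −α`
there exist `ε > 0` and `C > 0` depending only on `α, s` such that for all signs, dyadic
`N₁, N₂, N₃, N₄` and every `m ∈ ℤ`,
`∑_{n₁,…,n₄} (∏_j 1_{|n_j|∼N_j} ⟨n_j⟩^{−2+2α}) ⟨n₁+n₂+n₃+n₄⟩^{2s} ⟨n₁+n₂+n₃⟩^{−2}
  1_{|φ−m|≤1} ≤ C N₄^{−2ε} max(N₁,N₂,N₃)^{−2s_α}`. -/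
theorem quartic_nonresonance_sum (α s : ℝ) (hα0 : 0 < α) (hα1 : α < 5 / 12)
    (hs0 : -1 < s) (hs1 : s < -α) :
    ∃ ε C : ℝ, 0 < ε ∧ 0 < C ∧
      ∀ (σ σ₁ σ₂ σ₃ : ℝ), (σ = -1 ∨ σ = 1) → (σ₁ = -1 ∨ σ₁ = 1) →
        (σ₂ = -1 ∨ σ₂ = 1) → (σ₃ = -1 ∨ σ₃ = 1) →
        ∀ (k₁ k₂ k₃ k₄ : ℕ) (m : ℤ),
          (∑' v : Fin 4 → Fin 2 → ℤ,
            Set.indicator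
              {v : Fin 4 → Fin 2 → ℤ |
                ann ((2:ℝ)^k₁) (v 0) ∧ ann ((2:ℝ)^k₂) (v 1) ∧
                ann ((2:ℝ)^k₃) (v 2) ∧ ann ((2:ℝ)^k₄) (v 3) ∧
                |phase σ σ₁ σ₂ σ₃ (v 0) (v 1) (v 2) - (m : ℝ)| ≤ 1}
              (fun v => (jb (v 0) ^ (-2 + 2 * α) * jb (v 1) ^ (-2 + 2 * α) *
                  jb (v 2) ^ (-2 + 2 * α) * jb (v 3) ^ (-2 + 2 * α)) *
                jb (v 0 + v 1 + v 2 + v 3) ^ (2 * s) *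
                jb (v 0 + v 1 + v 2) ^ (-2 : ℝ)) v) ≤
            C * ((2:ℝ)^k₄) ^ (-2 * ε) *
              (max ((2:ℝ)^k₁) (max ((2:ℝ)^k₂) ((2:ℝ)^k₃))) ^ (-2 * sAlpha α) := by
  classical
  set θ := -(2 * α + 2 * s) / 3 with hθ
  have hθ0 : 0 < θ := by rw [hθ]; linarith
  obtain ⟨A, hA, hquart⟩ := exists_sum_ann_le α s θ (by rw [hθ]; ring) hα0 hs0 hs1
  obtain ⟨B, hB, hcub⟩ := exists_cubic_sum_le_max α θ hα0 hα1 hθ0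
  refine ⟨θ / 2, A * B + 1, by linarith, by positivity, ?_⟩
  intro σ σ₁ σ₂ σ₃ _ hσ₁ hσ₂ hσ₃ k₁ k₂ k₃ k₄ m
  have hN : ∀ k : ℕ, (1 : ℝ) ≤ 2 ^ k := fun k => one_le_pow₀ (by norm_num)
  set M := max ((2 : ℝ) ^ k₁) (max ((2 : ℝ) ^ k₂) ((2 : ℝ) ^ k₃)) with hM
  have hM0 : 0 < M := lt_max_of_lt_left (by positivity)
  refine Real.tsum_le_of_sum_le (fun v => Set.indicator_nonneg (fun v _ => ?_) v) fun u => ?_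
  · have := jb_pos (v 0)
    have := jb_pos (v 1)
    have := jb_pos (v 2)
    have := jb_pos (v 3)
    have := jb_pos (v 0 + v 1 + v 2)
    have := jb_pos (v 0 + v 1 + v 2 + v 3)
    positivity
  suffices hfin : ∀ T : Finset (Fin 4 → Fin 2 → ℤ),
      (∀ v ∈ T, ann ((2:ℝ)^k₁) (v 0) ∧ ann ((2:ℝ)^k₂) (v 1) ∧
        ann ((2:ℝ)^k₃) (v 2) ∧ ann ((2:ℝ)^k₄) (v 3) ∧
        |phase σ σ₁ σ₂ σ₃ (v 0) (v 1) (v 2) - (m : ℝ)| ≤ 1) →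
      ∑ v ∈ T, (jb (v 0) ^ (-2 + 2 * α) * jb (v 1) ^ (-2 + 2 * α) *
          jb (v 2) ^ (-2 + 2 * α) * jb (v 3) ^ (-2 + 2 * α)) *
        jb (v 0 + v 1 + v 2 + v 3) ^ (2 * s) * jb (v 0 + v 1 + v 2) ^ (-2 : ℝ) ≤
        (A * B + 1) * ((2:ℝ)^k₄) ^ (-2 * (θ / 2)) * M ^ (-2 * sAlpha α) by
    rw [Finset.sum_indicator_eq_sum_filter]
    exact hfin _ fun v hv => (Finset.mem_filter.mp hv).2
  intro T hTm
  set g : (Fin 4 → Fin 2 → ℤ) → (Fin 2 → ℤ) × (Fin 2 → ℤ) × (Fin 2 → ℤ) :=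
    fun v => (v 0, v 1, v 2) with hg
  rw [← Finset.sum_fiberwise_of_maps_to (t := T.image g) (g := g)
    fun v hv => Finset.mem_image_of_mem _ hv]
  have hinner : ∀ p ∈ T.image g, ∑ v ∈ T.filter (fun v => g v = p),
      (jb (v 0) ^ (-2 + 2 * α) * jb (v 1) ^ (-2 + 2 * α) *
        jb (v 2) ^ (-2 + 2 * α) * jb (v 3) ^ (-2 + 2 * α)) *
        jb (v 0 + v 1 + v 2 + v 3) ^ (2 * s) * jb (v 0 + v 1 + v 2) ^ (-2 : ℝ) ≤
      A * ((2 : ℝ) ^ k₄) ^ (-θ) *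
        (jb p.1 ^ (-2 + 2 * α) * jb p.2.1 ^ (-2 + 2 * α) * jb p.2.2 ^ (-2 + 2 * α) *
          jb (p.1 + p.2.1 + p.2.2) ^ (-2 - θ)) := by
    rintro ⟨x, y, z⟩ -
    have hx := jb_pos x
    have hy := jb_pos y
    have hz := jb_pos z
    have hn := jb_pos (x + y + z)
    set F := T.filter (fun v => g v = (x, y, z)) with hF
    have hFm : ∀ v ∈ F, v ∈ T ∧ v 0 = x ∧ v 1 = y ∧ v 2 = z := fun v hv => by
      simpa only [hF, hg, Finset.mem_filter, Prod.mk.injEq] using hv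
    have hinj : Set.InjOn (fun v : Fin 4 → Fin 2 → ℤ => v 3) F := by
      intro v hv v' hv' e
      obtain ⟨-, a, b, c⟩ := hFm v hv
      obtain ⟨-, a', b', c'⟩ := hFm v' hv'
      funext i
      fin_cases i
      · exact a.trans a'.symm
      · exact b.trans b'.symm
      · exact c.trans c'.symm
      · exact e
    calc _ = ∑ v ∈ F, (jb x ^ (-2 + 2 * α) * jb y ^ (-2 + 2 * α) * jb z ^ (-2 + 2 * α) *
          jb (x + y + z) ^ (-2 : ℝ)) *
          (fun w => jb w ^ (-2 + 2 * α) * jb (x + y + z + w) ^ (2 * s)) (v 3) := by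
          refine Finset.sum_congr rfl fun v hv => ?_
          obtain ⟨-, a, b, c⟩ := hFm v hv
          rw [a, b, c]
          ring
      _ = (jb x ^ (-2 + 2 * α) * jb y ^ (-2 + 2 * α) * jb z ^ (-2 + 2 * α) *
          jb (x + y + z) ^ (-2 : ℝ)) * ∑ w ∈ F.image (fun v => v 3),
            jb w ^ (-2 + 2 * α) * jb (x + y + z + w) ^ (2 * s) := by
          rw [← Finset.mul_sum, Finset.sum_image hinj]
      _ ≤ (jb x ^ (-2 + 2 * α) * jb y ^ (-2 + 2 * α) * jb z ^ (-2 + 2 * α) *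
          jb (x + y + z) ^ (-2 : ℝ)) *
            (A * ((2 : ℝ) ^ k₄) ^ (-θ) * jb (x + y + z) ^ (-θ)) := by
          gcongr
          refine hquart _ _ _ (hN k₄) fun w hw => ?_
          obtain ⟨v, hv, rfl⟩ := Finset.mem_image.mp hw
          exact (hTm v (hFm v hv).1).2.2.2.1
      _ = _ := by
          rw [sub_eq_add_neg (-2) θ, Real.rpow_add hn]
          ring
  refine (Finset.sum_le_sum hinner).trans ?_
  rw [← Finset.mul_sum]
  calc _ ≤ A * ((2 : ℝ) ^ k₄) ^ (-θ) * (B * M ^ (-2 * sAlpha α)) := by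
        gcongr
        refine hcub _ _ _ σ σ₁ σ₂ σ₃ m (hN k₁) (hN k₂) (hN k₃) hσ₁ hσ₂ hσ₃ (T.image g)
          (fun p => p.1) (fun p => p.2.1) (fun p => p.2.2) (fun _ _ _ _ e => e) fun p hp => ?_
        obtain ⟨v, hv, rfl⟩ := Finset.mem_image.mp hp
        obtain ⟨a, b, c, -, d⟩ := hTm v hv
        exact ⟨a, b, c, d⟩
    _ = A * B * (((2 : ℝ) ^ k₄) ^ (-θ) * M ^ (-2 * sAlpha α)) := by ring
    _ ≤ (A * B + 1) * (((2 : ℝ) ^ k₄) ^ (-θ) * M ^ (-2 * sAlpha α)) := by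
        gcongr
        linarith
    _ = _ := by
        rw [show -2 * (θ / 2) = -θ by ring]
        ring
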